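/- Let A ∈ ℝ^{n×n} be such that all eigenvalues of A have strictly negative real part (A is Hurwitz stable). Then there exist J, R, Q ∈ ℝ^{n×n} with Jᵀ = −J, R symmetric positive semidefinite, Q symmetric positive definite, and A = (J−R)Q. -/

import Mathlib

open Matrix Complex

open scoped ComplexOrder MatrixOrder Matrix.Norms.L2Operator Topology

/-- A real matrix whose complexification is positive semidefinite is positive semidefinite. -/
theorem Matrix.PosSemidef.of_map_ofReal {ι : Type*} [Fintype ι] {M : Matrix ι ι ℝ}
    (h : (M.map Complex.ofReal).PosSemidef) : M.PosSemidef := by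
  refine PosSemidef.of_dotProduct_mulVec_nonneg ?_ fun x => ?_
  · ext i j
    have := h.isHermitian.apply i j
    simpa using this
  · have := h.dotProduct_mulVec_nonneg (fun i => (x i : ℂ))
    have e : star (fun i => (x i : ℂ)) ⬝ᵥ (M.map Complex.ofReal *ᵥ fun i => (x i : ℂ)) =
        ((star x ⬝ᵥ (M *ᵥ x) : ℝ) : ℂ) := by
      simp [dotProduct, mulVec]
    rw [e] at this
    exact_mod_cast this

/-- A contraction `M` satisfies `M * Mᴴ ≤ 1`. -/
theorem Matrix.posSemidef_one_sub_mul_conjTranspose {ι : Type*} [Fintype ι] [DecidableEq ι]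
    {M : Matrix ι ι ℂ} (h : ‖M‖ ≤ 1) : (1 - M * Mᴴ).PosSemidef := by
  rw [← Matrix.le_iff]
  refine (CStarAlgebra.norm_le_one_iff_of_nonneg (M * Mᴴ)
    (posSemidef_self_mul_conjTranspose M).nonneg).1 ?_
  rw [← star_eq_conjTranspose, CStarRing.norm_self_mul_star]
  exact mul_le_one₀ h (norm_nonneg _) h

/-- Some positive power of an element of spectral radius less than one is a contraction. -/
theorem exists_norm_pow_le_one_of_spectralRadius_lt_one {𝔸 : Type*} [NormedRing 𝔸]
    [NormedAlgebra ℂ 𝔸] [CompleteSpace 𝔸] {a : 𝔸} (h : spectralRadius ℂ a < 1) :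
    ∃ N : ℕ, 0 < N ∧ ‖a ^ N‖ ≤ 1 := by
  obtain ⟨N, hN, hpos⟩ :=
    (((spectrum.pow_nnnorm_pow_one_div_tendsto_nhds_spectralRadius a).eventually_lt_const
      h).and (Filter.eventually_gt_atTop 0)).exists
  refine ⟨N, hpos, ?_⟩
  by_contra! hlt
  refine hN.not_ge (ENNReal.one_le_rpow ?_ (by positivity))
  exact_mod_cast hlt.le

/-- A forward Euler step of small size for a Hurwitz matrix has spectral radius less than one. -/
theorem Matrix.exists_spectralRadius_one_add_smul_lt_one {ι : Type*} [Fintype ι] [DecidableEq ι]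
    (A : Matrix ι ι ℂ) (h : ∀ z ∈ spectrum ℂ A, z.re < 0) :
    ∃ ε : ℝ, 0 < ε ∧ spectralRadius ℂ (1 + (ε : ℂ) • A) < 1 := by
  have hev : ∀ᶠ ε : ℝ in 𝓝[>] 0, ∀ z ∈ spectrum ℂ A, ‖1 + (ε : ℂ) * z‖ < 1 := by
    refine (Filter.eventually_all_finite A.finite_spectrum).2 fun z hz => ?_
    have hlim : Filter.Tendsto (fun ε : ℝ => 2 * z.re + ε * normSq z) (𝓝[>] 0)
        (𝓝 (2 * z.re + 0 * normSq z)) :=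
      ((by fun_prop : Continuous fun ε : ℝ => 2 * z.re + ε * normSq z).tendsto 0).mono_left
        nhdsWithin_le_nhds
    filter_upwards [hlim.eventually_lt_const (u := 0) (by linarith [h z hz]),
      self_mem_nhdsWithin] with ε hε hpos
    have hsq : ‖1 + (ε : ℂ) * z‖ ^ 2 = 1 + ε * (2 * z.re + ε * normSq z) := by
      rw [← Complex.normSq_eq_norm_sq]
      simp [Complex.normSq_apply]
      ring
    have := mul_neg_of_pos_of_neg hpos hε
    nlinarith [norm_nonneg (1 + (ε : ℂ) * z)]
  obtain ⟨ε, hε, hpos⟩ := (hev.and self_mem_nhdsWithin).exists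
  have hpos : 0 < ε := hpos
  refine ⟨ε, hpos, ?_⟩
  cases subsingleton_or_nontrivial (Matrix ι ι ℂ)
  · simp [spectralRadius]
  refine spectrum.spectralRadius_lt_of_forall_lt (r := 1) _ fun w hw => ?_
  have hε0 : (ε : ℂ) ≠ 0 := by exact_mod_cast hpos.ne'
  rw [← map_one (algebraMap ℂ (Matrix ι ι ℂ)), ← spectrum.singleton_add_eq,
    ← Units.smul_mk0 hε0, spectrum.unit_smul_eq_smul] at hw
  obtain ⟨_, rfl, _, ⟨z, hz, rfl⟩, rfl⟩ := hw
  exact hε z hz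

/-- The Lyapunov theorem, in its non-strict form: a Hurwitz matrix admits a positive definite
solution of the Lyapunov inequality. -/
theorem Matrix.exists_posDef_lyapunov {ι : Type*} [Fintype ι] [DecidableEq ι]
    (A : Matrix ι ι ℝ) (h : ∀ z ∈ spectrum ℂ (A.map Complex.ofReal), z.re < 0) :
    ∃ X : Matrix ι ι ℝ, X.PosDef ∧ (-(A * X + X * Aᵀ)).PosSemidef := by
  obtain ⟨ε, hε, hρ⟩ := exists_spectralRadius_one_add_smul_lt_one _ h
  obtain ⟨N, hN, hle⟩ := exists_norm_pow_le_one_of_spectralRadius_lt_one hρ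
  set B : Matrix ι ι ℝ := 1 + ε • A with hB
  have hmap : (1 + (ε : ℂ) • A.map Complex.ofReal) ^ N = (B ^ N).map Complex.ofReal := by
    have hBmap : 1 + (ε : ℂ) • A.map Complex.ofReal = Complex.ofRealHom.mapMatrix B := by
      ext i j
      by_cases hij : i = j <;> simp [hB, hij]
    rw [hBmap, ← map_pow]
    rfl
  have hcontr : (1 - B ^ N * (B ^ N)ᵀ).PosSemidef := by
    refine PosSemidef.of_map_ofReal ?_
    convert posSemidef_one_sub_mul_conjTranspose hle using 1
    rw [hmap]
    ext i j
    by_cases hij : i = j <;> simp [hij, mul_apply, -transpose_pow]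
  let X := ∑ k ∈ Finset.range N, B ^ k * (B ^ k)ᵀ
  have hterm (k : ℕ) : (B ^ k * (B ^ k)ᵀ).PosSemidef := by
    simpa using posSemidef_self_mul_conjTranspose (B ^ k)
  have hX : X.PosDef := by
    obtain ⟨m, rfl⟩ := Nat.exists_eq_succ_of_ne_zero hN.ne'
    simp only [X, Finset.sum_range_succ', pow_zero, transpose_one, mul_one]
    exact PosDef.posSemidef_add (posSemidef_sum _ fun k _ => hterm _) PosDef.one
  have htel : X - B * X * Bᵀ = 1 - B ^ N * (B ^ N)ᵀ := by
    have hshift : B * X * Bᵀ = ∑ k ∈ Finset.range N, B ^ (k + 1) * (B ^ (k + 1))ᵀ := by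
      simp only [X, Finset.mul_sum, Finset.sum_mul, pow_succ', transpose_mul, mul_assoc]
    rw [hshift, ← Finset.sum_sub_distrib, Finset.sum_range_sub' fun k => B ^ k * (B ^ k)ᵀ]
    simp
  have hAXA : (A * X * Aᵀ).PosSemidef := by
    simpa using hX.posSemidef.mul_mul_conjTranspose_same A
  refine ⟨X, hX, ?_⟩
  have key : -(A * X + X * Aᵀ) = ε⁻¹ • (1 - B ^ N * (B ^ N)ᵀ) + ε • (A * X * Aᵀ) := by
    have hexp : X - B * X * Bᵀ = ε • (-(A * X + X * Aᵀ) - ε • (A * X * Aᵀ)) := by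
      simp only [hB, transpose_add, transpose_one, transpose_smul, add_mul, mul_add, one_mul,
        mul_one, smul_mul_assoc, mul_smul_comm, smul_sub, smul_neg, smul_add]
      abel
    rw [← htel, hexp, inv_smul_smul₀ hε.ne']
    abel
  rw [key]
  exact (hcontr.smul (inv_nonneg.2 hε.le)).add (hAXA.smul hε.le)

theorem stmt_11 {n : ℕ} (A : Matrix (Fin n) (Fin n) ℝ)
    (hstab : ∀ lam : ℂ, lam ∈ spectrum ℂ (A.map (Complex.ofReal)) → lam.re < 0) :
    ∃ J R Q : Matrix (Fin n) (Fin n) ℝ,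
      Jᵀ = -J ∧ R.PosSemidef ∧ Q.PosDef ∧ A = (J - R) * Q := by
  obtain ⟨X, hX, hR⟩ := exists_posDef_lyapunov A hstab
  have hXt : Xᵀ = X := by simpa using hX.isHermitian.eq
  refine ⟨(1 / 2 : ℝ) • (A * X - X * Aᵀ), (1 / 2 : ℝ) • -(A * X + X * Aᵀ), X⁻¹, ?_,
    hR.smul (by norm_num), hX.inv, ?_⟩
  · simp only [transpose_smul, transpose_sub, transpose_mul, transpose_transpose, hXt,
      ← smul_neg, neg_sub]
  · have hJR : (1 / 2 : ℝ) • (A * X - X * Aᵀ) - (1 / 2 : ℝ) • -(A * X + X * Aᵀ) = A * X := by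
      module
    rw [hJR, mul_nonsing_inv_cancel_right _ _ ((isUnit_iff_isUnit_det X).1 hX.isUnit)]
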